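/- If (Φ_n) is a sequence of automorphisms of F such that sup_n L(Φ_n) < ∞, then for every f ∈ F the cyclically reduced lengths are uniformly bounded: sup_n ||Φ_n(f)|| < ∞. -/

import Mathlib

open MeasureTheory Filter Topology
open scoped ENNReal NNReal

namespace FGC

noncomputable section

variable (k : ℕ)

/-- The alphabet `A = Σ ∪ Σ⁻¹`: a letter is a basis element together with a sign. -/
abbrev L := Fin k × Bool

/-- The inverse of a letter. -/
def linv (a : L k) : L k := (a.1, !a.2)

/-- A right-infinite word is (freely) reduced if no letter is followed by its inverse. -/
def Red (x : ℕ → L k) : Prop := ∀ n, x (n + 1) ≠ linv k (x n)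

/-- The boundary `∂F`: the set of infinite freely reduced words in the alphabet `A`. -/
def Boundary : Type := { x : ℕ → L k // Red k x }

instance : TopologicalSpace (Boundary k) :=
  inferInstanceAs (TopologicalSpace { x : ℕ → L k // Red k x })

instance : MeasurableSpace (Boundary k) := borel _

instance : BorelSpace (Boundary k) := ⟨rfl⟩

/-- The free group of rank `k`. -/
abbrev F := FreeGroup (Fin k)

/-- The word length `|v|` of an element of `F`. -/
def wordLength (v : F k) : ℕ := v.toWord.length

/-- The cyclically reduced length `‖v‖`: the minimal word length among conjugates of `v`. -/
def cyclLength (v : F k) : ℕ := sInf { n | ∃ g : F k, wordLength k (g * v * g⁻¹) = n }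

/-- The cylinder `Cyl v ⊆ ∂F` of rays starting with the reduced word of `v`. -/
def Cyl (v : F k) : Set (Boundary k) :=
  { x | ∀ i : Fin v.toWord.length, x.1 i = v.toWord.get i }

/-- The shift deleting the first letter of a ray. -/
def shift (x : ℕ → L k) : ℕ → L k := fun n => x (n + 1)

/-- Prepending a letter to a ray. -/
def cons (a : L k) (x : ℕ → L k) : ℕ → L k
  | 0 => a
  | n + 1 => x n

/-- Prepending a (reversed) finite word to a ray, performing free reduction. -/
def prependAux : List (L k) → (ℕ → L k) → ℕ → L k
  | [], x => x
  | a :: r, x => prependAux r (if x 0 = linv k a then shift k x else cons k a x)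

theorem red_shift {x : ℕ → L k} (hx : Red k x) : Red k (shift k x) :=
  fun n => hx (n + 1)

theorem red_cons {a : L k} {x : ℕ → L k} (hx : Red k x) (h : x 0 ≠ linv k a) :
    Red k (cons k a x) := by
  intro n
  cases n with
  | zero => exact h
  | succ m => exact hx m

theorem red_prependAux : ∀ (r : List (L k)) {x : ℕ → L k}, Red k x → Red k (prependAux k r x)
  | [], _, hx => hx
  | a :: r, x, hx => by
    by_cases h : x 0 = linv k a
    · simp only [prependAux, if_pos h]
      exact red_prependAux r (red_shift k hx)
    · simp only [prependAux, if_neg h]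
      exact red_prependAux r (red_cons k hx h)

/-- The left-translation action of `F` on `∂F`: concatenate and freely reduce. -/
def act (g : F k) (x : Boundary k) : Boundary k :=
  ⟨prependAux k g.toWord.reverse x.1, red_prependAux k _ x.2⟩

/-- The shift map `T : ∂F → ∂F`. -/
def Tmap (x : Boundary k) : Boundary k := ⟨shift k x.1, red_shift k x.2⟩

/-- The double boundary `∂²F`, as the complement of the diagonal. -/
def D2 : Set (Boundary k × Boundary k) := { p | p.1 ≠ p.2 }

/-- The diagonal action of `F` on `∂F × ∂F`. -/
def actPair (g : F k) (p : Boundary k × Boundary k) : Boundary k × Boundary k :=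
  (act k g p.1, act k g p.2)

/-- The cylinder `Cyl[1,w]` of geodesics through the segment from `1` to `w`. -/
def baseCyl (w : F k) : Set (Boundary k × Boundary k) :=
  { p | p.1.1 0 ≠ p.2.1 0 ∧ p.2 ∈ Cyl k w }

/-- The base-ball `B = Cyl[1,1]` of geodesics through the base point. -/
def baseBall : Set (Boundary k × Boundary k) := baseCyl k 1

/-- The cylinder `Cyl[x,y] = x · Cyl[1, x⁻¹y]`. -/
def Cyl2 (x y : F k) : Set (Boundary k × Boundary k) :=
  actPair k x '' baseCyl k (x⁻¹ * y)

/-- A geodesic current: a Borel measure on `∂F × ∂F` giving no mass to the diagonal,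
invariant under the diagonal `F`-action, and finite on compact subsets of `∂²F`. -/
def IsCurrent (η : Measure (Boundary k × Boundary k)) : Prop :=
  η { p | p.1 = p.2 } = 0 ∧
  (∀ g : F k, ∀ W : Set (Boundary k × Boundary k), MeasurableSet W →
    η (actPair k g ⁻¹' W) = η W) ∧
  (∀ K : Set (Boundary k × Boundary k), K ⊆ D2 k → IsCompact K → η K < ⊤)

/-- The element of `F` given by the first `n` letters of a ray. -/
def prefixEl (x : Boundary k) (n : ℕ) : F k :=
  FreeGroup.mk (List.ofFn fun i : Fin n => x.1 i)

/-- `b : ∂F → ∂F` is the boundary extension of the automorphism `Φ`: for every ray `x`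
and every `m`, the length-`m` prefix of `b x` is the length-`m` prefix of the reduced
word of `Φ (x|_n)` for all sufficiently large `n`. -/
def IsBdryExt (Φ : F k ≃* F k) (b : Boundary k → Boundary k) : Prop :=
  ∀ x : Boundary k, ∀ m : ℕ, ∃ N : ℕ, ∀ n ≥ N,
    (Φ (prefixEl k x n)).toWord.take m = List.ofFn fun i : Fin m => (b x).1 i

/-- The map `∂Φ × ∂Φ` on pairs. -/
def pairMap (b : Boundary k → Boundary k) (p : Boundary k × Boundary k) :
    Boundary k × Boundary k := (b p.1, b p.2)

/-- The length of an automorphism with boundary map `b`, w.r.t. the current `η`: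
`L(Φ) = η((∂Φ × ∂Φ)⁻¹ B)`. -/
def autLen (η : Measure (Boundary k × Boundary k)) (b : Boundary k → Boundary k) : ℝ≥0∞ :=
  η (pairMap k b ⁻¹' baseBall k)

/-- The subgroup of inner automorphisms. -/
abbrev Inn : Subgroup (MulAut (F k)) := (MulAut.conj : F k →* MulAut (F k)).range

/-- `Out(F) = Aut(F)/Inn(F)` as a coset space. -/
abbrev OutQ := MulAut (F k) ⧸ Inn k

/-- A simple automorphism: induced by a permutation of the basis, or inner. -/
def SimpleAut (Φ : MulAut (F k)) : Prop :=
  (∃ σ : Equiv.Perm (Fin k), ∀ i, Φ (FreeGroup.of i) = FreeGroup.of (σ i)) ∨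
  (∃ v : F k, ∀ x, Φ x = v * x * v⁻¹)

/-- A Whitehead automorphism of the second kind. -/
def Whitehead2 (τ : MulAut (F k)) : Prop :=
  ∃ a : Fin k, ∀ i : Fin k,
    τ (FreeGroup.of i) = FreeGroup.of i ∨
    τ (FreeGroup.of i) = FreeGroup.of i * FreeGroup.of a ∨
    τ (FreeGroup.of i) = (FreeGroup.of a)⁻¹ * FreeGroup.of i ∨
    τ (FreeGroup.of i) = (FreeGroup.of a)⁻¹ * FreeGroup.of i * FreeGroup.of a

/-- The space of frequency measures: finite `T`-invariant Borel measures on `∂F`. -/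
def FreqM : Type :=
  { μ : Measure (Boundary k) //
    IsFiniteMeasure μ ∧ ∀ W : Set (Boundary k), MeasurableSet W → μ (Tmap k ⁻¹' W) = μ W }

/-- The space of geodesic currents. -/
def Currents : Type := { η : Measure (Boundary k × Boundary k) // IsCurrent k η }

/-- Continuous functions on `∂F × ∂F` with compact support contained in `∂²F`;
these are the test functions for the weak-* topology on currents. -/
def TestF : Type :=
  { φ : Boundary k × Boundary k → ℝ //
    Continuous φ ∧ IsCompact (tsupport φ) ∧ tsupport φ ⊆ D2 k }

/-- The weak-* topology on frequency measures. -/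
instance : TopologicalSpace (FreqM k) :=
  ⨅ φ : C(Boundary k, ℝ),
    TopologicalSpace.induced (fun μ : FreqM k => ∫ x, φ x ∂μ.1) inferInstance

/-- The weak-* topology on geodesic currents. -/
instance : TopologicalSpace (Currents k) :=
  ⨅ φ : TestF k,
    TopologicalSpace.induced (fun η : Currents k => ∫ p, φ.1 p ∂η.1) inferInstance

/-- Convergence of a sequence of group elements (as reduced words) to a boundary ray. -/
def WordTendsto (pn : ℕ → F k) (p : Boundary k) : Prop :=
  ∀ m : ℕ, ∃ N : ℕ, ∀ n ≥ N, (pn n).toWord.take m = List.ofFn fun i : Fin m => p.1 i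

/-- The length of the maximal common initial segment of two rays. -/
def commonLen (p : Boundary k × Boundary k) : ℕ :=
  sSup { m : ℕ | ∀ i < m, p.1.1 i = p.2.1 i }

/-- A single letter as an element of `F`. -/
def el (a : L k) : F k := FreeGroup.mk [a]

/-- The product of per-letter constants over the reduced word of `w`. -/
def Cprod (C : L k → ℝ≥0) (w : F k) : ℝ≥0 := (w.toWord.map C).prod

section Helpers

variable {k : ℕ}

@[simp]
theorem linv_linv (a : L k) : linv k (linv k a) = a := by
  simp [linv]

theorem isReduced_rel_iff {a b : L k} : (a.1 = b.1 → a.2 = b.2) ↔ b ≠ linv k a := by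
  rcases a with ⟨i, s⟩
  rcases b with ⟨j, t⟩
  cases s <;> cases t <;> simp [linv, eq_comm]

theorem isReduced_cons_iff {a : L k} {l : List (L k)} :
    FreeGroup.IsReduced (a :: l) ↔ (∀ b ∈ l.head?, b ≠ linv k a) ∧ FreeGroup.IsReduced l := by
  simp only [FreeGroup.IsReduced, List.isChain_cons, isReduced_rel_iff]

theorem toWord_mk_of_isReduced {l : List (L k)} (h : FreeGroup.IsReduced l) :
    (FreeGroup.mk l : F k).toWord = l := by
  rw [FreeGroup.toWord_mk, h.reduce_eq]

theorem el_mul_mk (a : L k) (l : List (L k)) : el k a * FreeGroup.mk l = FreeGroup.mk (a :: l) := by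
  simp [el]

theorem el_linv (a : L k) : el k (linv k a) = (el k a)⁻¹ := by
  simp [el, linv, FreeGroup.invRev]

theorem toWord_el_mul_of_cancel {a : L k} {g : F k} {l : List (L k)}
    (h : g.toWord = linv k a :: l) : (el k a * g).toWord = l := by
  have hl : FreeGroup.IsReduced l := by
    have := FreeGroup.isReduced_toWord (x := g)
    rw [h, isReduced_cons_iff] at this
    exact this.2
  have hg : g = el k (linv k a) * FreeGroup.mk l := by
    rw [el_mul_mk, ← h, FreeGroup.mk_toWord]
  rw [hg, el_linv, mul_inv_cancel_left, toWord_mk_of_isReduced hl]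

theorem toWord_el_mul_of_ne {a : L k} {g : F k} (h : ∀ b ∈ g.toWord.head?, b ≠ linv k a) :
    (el k a * g).toWord = a :: g.toWord := by
  have hl : FreeGroup.IsReduced (a :: g.toWord) :=
    isReduced_cons_iff.2 ⟨h, FreeGroup.isReduced_toWord⟩
  conv_lhs => rw [← FreeGroup.mk_toWord (x := g), el_mul_mk]
  exact toWord_mk_of_isReduced hl

/-- Left translation of a ray by a single letter. -/
def letterAct (a : L k) (x : Boundary k) : Boundary k :=
  ⟨if x.1 0 = linv k a then shift k x.1 else cons k a x.1, by
    split_ifs with h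
    · exact red_shift k x.2
    · exact red_cons k x.2 h⟩

theorem letterAct_linv (a : L k) (x : Boundary k) :
    letterAct (linv k a) (letterAct a x) = x := by
  apply Subtype.ext
  by_cases h : x.1 0 = linv k a
  · have h1 : x.1 1 ≠ a := by
      have := x.2 0
      rwa [h, linv_linv] at this
    have h2 : (letterAct a x).1 = shift k x.1 := by simp [letterAct, h]
    have h3 : (shift k x.1) 0 ≠ linv k (linv k a) := by simpa [shift] using h1
    change (if (letterAct a x).1 0 = _ then _ else _) = _
    rw [h2, if_neg h3]
    funext n
    cases n with
    | zero => exact h.symm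
    | succ n => rfl
  · have h2 : (letterAct a x).1 = cons k a x.1 := by simp [letterAct, h]
    change (if (letterAct a x).1 0 = _ then _ else _) = _
    rw [h2, if_pos (by simp [cons])]
    rfl

/-- Translation of rays by a letter, as a permutation. -/
def letterPerm (a : L k) : Equiv.Perm (Boundary k) where
  toFun := letterAct a
  invFun := letterAct (linv k a)
  left_inv := letterAct_linv a
  right_inv x := by simpa using letterAct_linv (linv k a) x

/-- The action of `F` on rays, as a homomorphism to permutations. -/
def rayHom : F k →* Equiv.Perm (Boundary k) :=
  FreeGroup.lift fun i => letterPerm (i, true)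

theorem rayHom_el (a : L k) : rayHom (el k a) = letterPerm a := by
  rcases a with ⟨i, s⟩
  cases s
  · rw [el, rayHom, FreeGroup.lift_mk]
    ext x
    simp only [List.map_cons, List.map_nil, List.prod_singleton, cond_false]
    rfl
  · simp [el, rayHom, FreeGroup.lift_mk]

theorem prependAux_eq (r : List (L k)) (x : Boundary k) :
    prependAux k r x.1 = (rayHom (FreeGroup.mk r.reverse) x).1 := by
  induction r generalizing x with
  | nil => simp [prependAux, ← FreeGroup.one_eq_mk]
  | cons a r ih =>
    have h : (FreeGroup.mk (a :: r).reverse : F k) = FreeGroup.mk r.reverse * el k a := by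
      simp [el]
    rw [h, map_mul, Equiv.Perm.mul_apply, rayHom_el, prependAux]
    exact ih (letterAct a x)

instance : MulAction (F k) (Boundary k) where
  smul := act k
  one_smul x := by
    apply Subtype.ext
    change prependAux k _ _ = _
    simp [prependAux]
  mul_smul g h x := by
    have key : ∀ (g : F k) (x : Boundary k), act k g x = rayHom g x := fun g x => by
      apply Subtype.ext
      change prependAux k _ _ = _
      rw [prependAux_eq, List.reverse_reverse, FreeGroup.mk_toWord]
    change act k _ _ = act k _ (act k _ _)
    rw [key, key, key, map_mul, Equiv.Perm.mul_apply]

theorem smul_eq_rayHom (g : F k) (x : Boundary k) : g • x = rayHom g x := by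
  apply Subtype.ext
  change prependAux k _ _ = _
  rw [prependAux_eq, List.reverse_reverse, FreeGroup.mk_toWord]

theorem el_smul (a : L k) (x : Boundary k) : el k a • x = letterAct a x := by
  rw [smul_eq_rayHom, rayHom_el]
  rfl

theorem el_smul_val_of_eq {a : L k} {x : Boundary k} (h : x.1 0 = linv k a) :
    (el k a • x).1 = shift k x.1 := by
  rw [el_smul]
  simp [letterAct, h]

theorem el_smul_val_of_ne {a : L k} {x : Boundary k} (h : x.1 0 ≠ linv k a) :
    (el k a • x).1 = cons k a x.1 := by
  rw [el_smul]
  simp [letterAct, h]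

/-- Rays starting with the letters of a list. -/
def listCyl (l : List (L k)) : Set (Boundary k) :=
  { x | ∀ i (h : i < l.length), x.1 i = l[i] }

theorem Cyl_eq_listCyl (v : F k) : Cyl k v = listCyl v.toWord := by
  ext x
  exact ⟨fun h i hi => h ⟨i, hi⟩, fun h i => h i.1 i.2⟩

theorem mem_listCyl_cons {a : L k} {l : List (L k)} {x : Boundary k} :
    x ∈ listCyl (a :: l) ↔ x.1 0 = a ∧ Tmap k x ∈ listCyl l := by
  constructor
  · intro h
    exact ⟨h 0 (by simp), fun i hi => h (i + 1) (by simpa using hi)⟩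
  · rintro ⟨h0, h⟩ i hi
    cases i with
    | zero => exact h0
    | succ i => exact h i (by simpa using hi)

@[simp]
theorem mem_listCyl_singleton {a : L k} {x : Boundary k} : x ∈ listCyl [a] ↔ x.1 0 = a := by
  rw [mem_listCyl_cons]
  simp [listCyl]

theorem Tmap_el_smul {a : L k} {x : Boundary k} (h : x.1 0 ≠ linv k a) :
    Tmap k (el k a • x) = x := by
  apply Subtype.ext
  change shift k (el k a • x).1 = _
  rw [el_smul_val_of_ne h]
  rfl

theorem el_smul_head_of_ne {a : L k} {x : Boundary k} (h : x.1 0 ≠ linv k a) :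
    (el k a • x).1 0 = a := by
  rw [el_smul_val_of_ne h]
  rfl

theorem el_smul_head_eq_iff {a : L k} {x : Boundary k} :
    (el k a • x).1 0 = a ↔ x.1 0 ≠ linv k a := by
  refine ⟨fun h h' => ?_, el_smul_head_of_ne⟩
  rw [el_smul_val_of_eq h'] at h
  have := x.2 0
  rw [h', linv_linv] at this
  exact this h

theorem el_smul_mem_listCyl_cons {a : L k} {l : List (L k)} (hl : l ≠ [])
    (h : FreeGroup.IsReduced (a :: l)) {x : Boundary k} :
    el k a • x ∈ listCyl (a :: l) ↔ x ∈ listCyl l := by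
  rw [mem_listCyl_cons, el_smul_head_eq_iff]
  constructor
  · rintro ⟨h1, h2⟩
    rwa [Tmap_el_smul h1] at h2
  · intro hx
    have h1 : x.1 0 ≠ linv k a := by
      obtain ⟨b, l, rfl⟩ := List.exists_cons_of_ne_nil hl
      rw [(mem_listCyl_cons.1 hx).1]
      exact (isReduced_cons_iff.1 h).1 b rfl
    refine ⟨h1, ?_⟩
    rwa [Tmap_el_smul h1]

theorem mk_smul_mem_listCyl_append {u l : List (L k)} (hl : l ≠ [])
    (h : FreeGroup.IsReduced (u ++ l)) {x : Boundary k} :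
    (FreeGroup.mk u : F k) • x ∈ listCyl (u ++ l) ↔ x ∈ listCyl l := by
  induction u with
  | nil => simp [← FreeGroup.one_eq_mk]
  | cons a u ih =>
    rw [List.cons_append] at h
    rw [← el_mul_mk, mul_smul, List.cons_append, el_smul_mem_listCyl_cons (by simp [hl]) h,
      ih (isReduced_cons_iff.1 h).2]

theorem mk_smul_mem_listCyl_concat {u : List (L k)} {a : L k}
    (h : FreeGroup.IsReduced (u ++ [a])) {x : Boundary k} :
    (FreeGroup.mk (u ++ [a]) : F k) • x ∈ listCyl (u ++ [a]) ↔ x.1 0 ≠ linv k a := by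
  rw [← FreeGroup.mul_mk, mul_smul, mk_smul_mem_listCyl_append (by simp) h]
  change el k a • x ∈ _ ↔ _
  rw [mem_listCyl_singleton, el_smul_head_eq_iff]

/-- A nontrivial element moves two rays with distinct first letters to rays with the same first
letter, unless one of them starts with the letter cancelled by the last letter of the element. -/
theorem exists_letter_of_smul_head_ne {g : F k} (hg : g ≠ 1) :
    ∃ e : L k, ∀ x y : Boundary k, x.1 0 ≠ e → y.1 0 ≠ e → (g • x).1 0 = (g • y).1 0 := by
  have hne : g.toWord ≠ [] := by simpa using hg
  obtain ⟨u, a, hu⟩ := List.eq_nil_or_concat' g.toWord |>.resolve_left hne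
  have hred : FreeGroup.IsReduced (u ++ [a]) := hu ▸ FreeGroup.isReduced_toWord
  have hgu : g = FreeGroup.mk (u ++ [a]) := by rw [← hu, FreeGroup.mk_toWord]
  refine ⟨linv k a, fun x y hx hy => ?_⟩
  have h1 := (mk_smul_mem_listCyl_concat hred).2 hx
  have h2 := (mk_smul_mem_listCyl_concat hred).2 hy
  rw [← hgu] at h1 h2
  rw [h1 0 (by simp), h2 0 (by simp)]

/-- If a group element preserves the property of a triple of having distinct first letters then it
is trivial. -/
theorem eq_one_of_smul_triple {g : F k} {x y z : Boundary k}
    (hxy : x.1 0 ≠ y.1 0) (hyz : y.1 0 ≠ z.1 0) (hxz : x.1 0 ≠ z.1 0)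
    (hxy' : (g • x).1 0 ≠ (g • y).1 0) (hyz' : (g • y).1 0 ≠ (g • z).1 0)
    (hxz' : (g • x).1 0 ≠ (g • z).1 0) : g = 1 := by
  by_contra hg
  obtain ⟨e, he⟩ := exists_letter_of_smul_head_ne hg
  by_cases hx : x.1 0 = e
  · exact hyz' (he _ _ (fun h => hxy (hx.trans h.symm)) (fun h => hxz (hx.trans h.symm)))
  · by_cases hy : y.1 0 = e
    · exact hxz' (he _ _ hx (fun h => hyz (hy.trans h.symm)))
    · exact hxy' (he _ _ hx hy)

theorem toWord_mul_el (u : F k) (a : L k) :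
    u.toWord = (u * el k a).toWord ++ [linv k a] ∨ (u * el k a).toWord = u.toWord ++ [a] := by
  have hu : u = FreeGroup.mk u.toWord := FreeGroup.mk_toWord.symm
  have hred : FreeGroup.IsReduced u.toWord := FreeGroup.isReduced_toWord
  by_cases h : ∃ p, u.toWord = p ++ [linv k a]
  · obtain ⟨p, hp⟩ := h
    left
    have h1 : u * el k a = FreeGroup.mk p := by
      rw [hu, hp, ← FreeGroup.mul_mk, mul_assoc]
      change _ * (el k (linv k a) * el k a) = _
      rw [el_linv, inv_mul_cancel, mul_one]
    rw [h1, toWord_mk_of_isReduced, hp]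
    rw [hp] at hred
    exact List.IsChain.left_of_append hred
  · right
    have h1 : u * el k a = FreeGroup.mk (u.toWord ++ [a]) := by
      rw [← FreeGroup.mul_mk, FreeGroup.mk_toWord, el]
    rw [h1, toWord_mk_of_isReduced]
    refine List.isChain_append.2 ⟨hred, by simp, fun x hx y hy => ?_⟩
    have hy : a = y := by simpa using hy
    subst hy
    rw [isReduced_rel_iff]
    rintro rfl
    obtain ⟨p, hp⟩ := List.mem_getLast?_eq_getLast hx
    exact h ⟨_, by rw [linv_linv, hp, List.dropLast_append_getLast]⟩

theorem take_toWord_mul_mk (b : List (L k)) (u : F k) {m : ℕ} (hm : m + b.length ≤ u.norm) :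
    (u * FreeGroup.mk b).toWord.take m = u.toWord.take m := by
  induction b generalizing u with
  | nil => simp [← FreeGroup.one_eq_mk]
  | cons a b ih =>
    rw [List.length_cons] at hm
    rw [← el_mul_mk, ← mul_assoc]
    unfold FreeGroup.norm at *
    rcases toWord_mul_el u a with h | h
    · have hl := congrArg List.length h
      simp only [List.length_append, List.length_singleton] at hl
      rw [ih _ (by omega), h, List.take_append_of_le_length (by omega)]
    · have hl := congrArg List.length h
      simp only [List.length_append, List.length_singleton] at hl
      rw [ih _ (by omega), h, List.take_append_of_le_length (by omega)]

theorem take_toWord_mul {u w : F k} {m : ℕ} (hm : m + w.norm ≤ u.norm) :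
    (u * w).toWord.take m = u.toWord.take m := by
  have := take_toWord_mul_mk w.toWord u hm
  rwa [FreeGroup.mk_toWord] at this

theorem exists_norm_map_le (Φ : F k →* F k) :
    ∃ K : ℕ, ∀ l : List (L k), (Φ (FreeGroup.mk l)).norm ≤ K * l.length := by
  refine ⟨Finset.univ.sup fun a : L k => (Φ (el k a)).norm, fun l => ?_⟩
  induction l with
  | nil => simp [← FreeGroup.one_eq_mk]
  | cons a l ih =>
    rw [← el_mul_mk, map_mul, List.length_cons]
    refine (FreeGroup.norm_mul_le _ _).trans ?_
    have := Finset.le_sup (f := fun a : L k => (Φ (el k a)).norm) (Finset.mem_univ a)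
    linarith

theorem isReduced_ofFn (x : Boundary k) (n : ℕ) :
    FreeGroup.IsReduced (List.ofFn fun i : Fin n => x.1 i) := by
  rw [FreeGroup.IsReduced, List.isChain_iff_getElem]
  intro i hi
  rw [isReduced_rel_iff]
  simpa using x.2 i

theorem toWord_prefixEl (x : Boundary k) (n : ℕ) :
    (prefixEl k x n).toWord = List.ofFn fun i : Fin n => x.1 i :=
  toWord_mk_of_isReduced (isReduced_ofFn x n)

theorem norm_prefixEl (x : Boundary k) (n : ℕ) : (prefixEl k x n).norm = n := by
  rw [FreeGroup.norm, toWord_prefixEl, List.length_ofFn]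

theorem prefixEl_succ (x : Boundary k) (n : ℕ) :
    prefixEl k x (n + 1) = el k (x.1 0) * prefixEl k (Tmap k x) n := by
  rw [prefixEl, List.ofFn_succ, ← el_mul_mk]
  rfl

theorem prefixEl_succ' (x : Boundary k) (n : ℕ) :
    prefixEl k x (n + 1) = prefixEl k x n * el k (x.1 n) := by
  rw [prefixEl, List.ofFn_succ', List.concat_eq_append, ← FreeGroup.mul_mk]
  rfl

/-- Letterwise convergence of group elements to a ray. -/
def RayTendsto (g : ℕ → F k) (ξ : Boundary k) : Prop :=
  ∀ i, ∀ᶠ n in atTop, (g n).toWord[i]? = some (ξ.1 i)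

theorem RayTendsto.unique {g : ℕ → F k} {ξ ξ' : Boundary k} (h : RayTendsto g ξ)
    (h' : RayTendsto g ξ') : ξ = ξ' := by
  apply Subtype.ext
  funext i
  obtain ⟨n, hn, hn'⟩ := ((h i).and (h' i)).exists
  rw [hn] at hn'
  exact Option.some.inj hn'

theorem RayTendsto.el_smul {g : ℕ → F k} {ξ : Boundary k} (h : RayTendsto g ξ) (a : L k) :
    RayTendsto (fun n => el k a * g n) (el k a • ξ) := by
  intro i
  by_cases h0 : ξ.1 0 = linv k a
  · filter_upwards [h 0, h (i + 1)] with n hn hi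
    obtain ⟨b, l, hl⟩ : ∃ b l, (g n).toWord = b :: l := by
      cases hw : (g n).toWord with
      | nil => simp [hw] at hn
      | cons b l => exact ⟨b, l, rfl⟩
    have hb : b = linv k a := by simpa [hl, h0] using hn
    rw [toWord_el_mul_of_cancel (hb ▸ hl), el_smul_val_of_eq h0]
    simpa [hl, shift] using hi
  · have hh : ∀ᶠ n in atTop, (el k a * g n).toWord = a :: (g n).toWord := by
      filter_upwards [h 0] with n hn
      apply toWord_el_mul_of_ne
      intro b hb
      rw [List.head?_eq_getElem?, hn] at hb
      rwa [← Option.some.inj hb]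
    rw [el_smul_val_of_ne h0]
    cases i with
    | zero =>
      filter_upwards [hh] with n hn
      simp [hn, cons]
    | succ i =>
      filter_upwards [hh, h i] with n hn hi
      simpa [hn, cons] using hi

theorem RayTendsto.smul {g : ℕ → F k} {ξ : Boundary k} (h : RayTendsto g ξ) (u : F k) :
    RayTendsto (fun n => u * g n) (u • ξ) := by
  obtain ⟨l, rfl⟩ : ∃ l, FreeGroup.mk l = u := ⟨_, FreeGroup.mk_toWord⟩
  induction l with
  | nil => simpa [← FreeGroup.one_eq_mk] using h
  | cons a l ih => simpa [← el_mul_mk, mul_smul, mul_assoc] using ih.el_smul a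

theorem IsBdryExt.rayTendsto {Φ : F k ≃* F k} {b : Boundary k → Boundary k}
    (h : IsBdryExt k Φ b) (x : Boundary k) : RayTendsto (fun n => Φ (prefixEl k x n)) (b x) := by
  intro i
  obtain ⟨N, hN⟩ := h x (i + 1)
  filter_upwards [eventually_ge_atTop N] with n hn
  have := congrArg (fun l : List (L k) => l[i]?) (hN n hn)
  simpa [List.getElem?_take, List.getElem?_ofFn, -List.ofFn_succ] using this

theorem IsBdryExt.el_smul {Φ : F k ≃* F k} {b : Boundary k → Boundary k}
    (h : IsBdryExt k Φ b) (a : L k) (x : Boundary k) : b (el k a • x) = Φ (el k a) • b x := by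
  have h1 := (h.rayTendsto x).smul (Φ (el k a))
  have h2 := h.rayTendsto (el k a • x)
  simp only [← map_mul] at h1
  by_cases h0 : x.1 0 = linv k a
  · refine h2.unique fun i => ?_
    have := (tendsto_add_atTop_nat 1).eventually (h1 i)
    filter_upwards [this] with n hn
    have hT : Tmap k x = el k a • x := Subtype.ext (el_smul_val_of_eq h0).symm
    rwa [prefixEl_succ, h0, el_linv, mul_inv_cancel_left, hT] at hn
  · refine RayTendsto.unique (fun i => ?_) h1
    have := (tendsto_add_atTop_nat 1).eventually (h2 i)
    filter_upwards [this] with n hn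
    rwa [prefixEl_succ, el_smul_head_of_ne h0, Tmap_el_smul h0] at hn

theorem IsBdryExt.map_smul {Φ : F k ≃* F k} {b : Boundary k → Boundary k}
    (h : IsBdryExt k Φ b) (u : F k) (x : Boundary k) : b (u • x) = Φ u • b x := by
  obtain ⟨l, rfl⟩ : ∃ l, FreeGroup.mk l = u := ⟨_, FreeGroup.mk_toWord⟩
  induction l with
  | nil => simp [← FreeGroup.one_eq_mk]
  | cons a l ih => rw [← el_mul_mk, mul_smul, h.el_smul, ih, map_mul, mul_smul]

/-- A path with bounded jumps converging to a ray passes close to every vertex of the ray. -/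
theorem RayTendsto.exists_norm_le {g : ℕ → F k} {ξ : Boundary k} (h : RayTendsto g ξ)
    (h0 : g 0 = 1) {K : ℕ} (hK : ∀ n, ((g (n + 1))⁻¹ * g n).norm ≤ K) (j : ℕ) :
    ∃ n, ((prefixEl k ξ j)⁻¹ * g n).norm ≤ K := by
  classical
  rcases Nat.eq_zero_or_pos j with rfl | hj
  · exact ⟨0, by simp [h0, prefixEl, ← FreeGroup.one_eq_mk]⟩
  have hex : ∃ n, (g n).toWord.take j = (prefixEl k ξ j).toWord := by
    have : ∀ᶠ n in atTop, ∀ i ∈ Finset.range j, (g n).toWord[i]? = some (ξ.1 i) :=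
      (Finset.eventually_all (Finset.range j)).2 fun i _ => h i
    obtain ⟨n, hn⟩ := this.exists
    refine ⟨n, List.ext_getElem? fun i => ?_⟩
    rw [toWord_prefixEl, List.getElem?_take, List.getElem?_ofFn]
    by_cases hi : i < j
    · simp [hi, hn i (Finset.mem_range.2 hi)]
    · simp [hi]
  obtain ⟨m, hm⟩ : ∃ m, Nat.find hex = m + 1 := by
    refine Nat.exists_eq_succ_of_ne_zero fun h => ?_
    have := congrArg List.length (Nat.find_spec hex)
    rw [h, h0, toWord_prefixEl, List.length_ofFn] at this
    simp at this
    omega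
  have hs := Nat.find_spec hex
  have hf := Nat.find_min hex (m := m) (by omega)
  rw [hm] at hs
  have hlt : (g (m + 1)).norm < j + K := by
    by_contra hcon
    apply hf
    have := take_toWord_mul (u := g (m + 1)) (w := (g (m + 1))⁻¹ * g m) (m := j)
      (by linarith [hK m])
    rw [mul_inv_cancel_left] at this
    rw [this, hs]
  refine ⟨m + 1, ?_⟩
  have hg : g (m + 1) = prefixEl k ξ j * FreeGroup.mk ((g (m + 1)).toWord.drop j) := by
    conv_lhs => rw [← FreeGroup.mk_toWord (x := g (m + 1)),
      ← List.take_append_drop j (g (m + 1)).toWord, hs, ← FreeGroup.mul_mk, FreeGroup.mk_toWord]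
  rw [hg, inv_mul_cancel_left]
  refine FreeGroup.norm_mk_le.trans ?_
  rw [List.length_drop]
  rw [FreeGroup.norm] at hlt
  omega

theorem IsBdryExt.leftInverse {Φ : MulAut (F k)} {b b' : Boundary k → Boundary k}
    (h : IsBdryExt k Φ b) (h' : IsBdryExt k Φ⁻¹ b') : Function.LeftInverse b' b := by
  intro x
  refine (h'.rayTendsto (b x)).unique fun i => ?_
  obtain ⟨K, hK⟩ := exists_norm_map_le Φ.toMonoidHom
  obtain ⟨C, hC⟩ := exists_norm_map_le (Φ⁻¹).toMonoidHom
  have hK' : ∀ g : F k, (Φ g).norm ≤ K * g.norm := fun g => by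
    have := hK g.toWord
    rwa [FreeGroup.mk_toWord] at this
  have hC' : ∀ g : F k, (Φ⁻¹ g).norm ≤ C * g.norm := fun g => by
    have := hC g.toWord
    rwa [FreeGroup.mk_toWord] at this
  have hjump : ∀ n, ((Φ (prefixEl k x (n + 1)))⁻¹ * Φ (prefixEl k x n)).norm ≤ K := fun n => by
    rw [prefixEl_succ', map_mul, mul_inv_rev, inv_mul_cancel_right, FreeGroup.norm_inv_eq]
    simpa [el] using hK [x.1 n]
  filter_upwards [eventually_gt_atTop (K * (i + C * K + 1))] with j hj
  obtain ⟨n, hn⟩ := (h.rayTendsto x).exists_norm_le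
    (by simp [prefixEl, ← FreeGroup.one_eq_mk]) hjump j
  set w : F k := (Φ (prefixEl k x n))⁻¹ * prefixEl k (b x) j with hw
  have hwn : w.norm ≤ K := by
    rw [← FreeGroup.norm_inv_eq, hw, mul_inv_rev, inv_inv]
    exact hn
  have hwC : (Φ⁻¹ w).norm ≤ C * K := (hC' w).trans (Nat.mul_le_mul_left _ hwn)
  have heq : prefixEl k (b x) j = Φ (prefixEl k x n) * w := by rw [hw, mul_inv_cancel_left]
  have hnj : i + C * K < n := by
    by_contra hcon
    have h1 : j ≤ (Φ (prefixEl k x n)).norm + w.norm := by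
      rw [← norm_prefixEl (b x) j, heq]
      exact FreeGroup.norm_mul_le _ _
    have h2 := hK' (prefixEl k x n)
    rw [norm_prefixEl] at h2
    have h3 : K * n ≤ K * (i + C * K) := Nat.mul_le_mul_left _ (by omega)
    have h4 : K * (i + C * K + 1) = K * (i + C * K) + K := by ring
    omega
  have hinv : Φ⁻¹ (prefixEl k (b x) j) = prefixEl k x n * Φ⁻¹ w := by
    rw [heq, map_mul, MulAut.inv_apply_self]
  have htake := take_toWord_mul (u := prefixEl k x n) (w := Φ⁻¹ w) (m := i + 1)
    (by rw [norm_prefixEl]; omega)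
  have := congrArg (fun l : List (L k) => l[i]?) htake
  simp only [List.getElem?_take, Nat.lt_succ_self, if_true, toWord_prefixEl] at this
  rw [hinv, this, List.getElem?_ofFn]
  simp [show i < n by omega]

theorem measurableSet_coord (i : ℕ) (a : L k) : MeasurableSet { x : Boundary k | x.1 i = a } := by
  have hc : Continuous fun x : Boundary k => x.1 i :=
    (continuous_apply i).comp continuous_subtype_val
  exact ((isOpen_discrete ({a} : Set (L k))).preimage hc).measurableSet

theorem measurableSet_listCyl (l : List (L k)) : MeasurableSet (listCyl l) := by
  have : listCyl l = ⋂ i : Fin l.length, { x : Boundary k | x.1 i = l[i] } := by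
    ext x
    simp only [Set.mem_iInter]
    exact ⟨fun h i => h i.1 i.2, fun h i hi => h ⟨i, hi⟩⟩
  rw [this]
  exact MeasurableSet.iInter fun i => measurableSet_coord _ _

instance : SecondCountableTopology (Boundary k) :=
  TopologicalSpace.Subtype.secondCountableTopology { x : ℕ → L k | Red k x }

theorem generateFrom_listCyl :
    MeasurableSpace.generateFrom (Set.range (listCyl (k := k))) =
      (inferInstance : MeasurableSpace (Boundary k)) := by
  apply le_antisymm
  · apply MeasurableSpace.generateFrom_le
    rintro _ ⟨l, rfl⟩
    exact measurableSet_listCyl l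
  · have hb := (PiNat.isTopologicalBasis_cylinders (fun _ : ℕ => L k)).induced
      (Subtype.val : Boundary k → ℕ → L k)
    change borel (Boundary k) ≤ _
    have he := TopologicalSpace.IsTopologicalBasis.borel_eq_generateFrom (α := Boundary k) hb
    rw [he]
    apply MeasurableSpace.generateFrom_le
    rintro _ ⟨_, ⟨x, n, rfl⟩, rfl⟩
    apply MeasurableSpace.measurableSet_generateFrom
    refine ⟨List.ofFn fun i : Fin n => x i, ?_⟩
    ext y
    simp only [listCyl, PiNat.cylinder, List.length_ofFn, List.getElem_ofFn,
      Set.mem_ofPred_eq]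
    exact Iff.rfl

theorem isPiSystem_listCyl : IsPiSystem (Set.range (listCyl (k := k))) := by
  rintro _ ⟨l, rfl⟩ _ ⟨l', rfl⟩ ⟨x, hx, hx'⟩
  rcases le_total l.length l'.length with h | h
  · refine ⟨l', (Set.inter_eq_right.2 fun y hy i hi => ?_).symm⟩
    rw [hy i (hi.trans_le h), ← hx' i (hi.trans_le h), hx i hi]
  · refine ⟨l, (Set.inter_eq_left.2 fun y hy i hi => ?_).symm⟩
    rw [hy i (hi.trans_le h), ← hx i (hi.trans_le h), hx' i hi]

theorem measurable_of_coord {α : Type*} [MeasurableSpace α] {h : α → Boundary k}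
    (hh : ∀ i a, MeasurableSet { y | (h y).1 i = a }) : Measurable h := by
  have hgen : instMeasurableSpaceBoundary k = _ := generateFrom_listCyl.symm
  rw [hgen]
  apply measurable_generateFrom
  rintro _ ⟨l, rfl⟩
  have : h ⁻¹' listCyl l = ⋂ i : Fin l.length, { y | (h y).1 i = l[i] } := by
    ext y
    simp only [Set.mem_iInter]
    exact ⟨fun h i => h i.1 i.2, fun h i hi => h ⟨i, hi⟩⟩
  rw [this]
  exact MeasurableSet.iInter fun i => hh _ _

theorem measurable_letterAct (a : L k) : Measurable (letterAct a) := by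
  apply measurable_of_coord
  intro i b
  have : { y : Boundary k | (letterAct a y).1 i = b } =
      ({ y | y.1 0 = linv k a } ∩ { y | y.1 (i + 1) = b }) ∪
      ({ y | y.1 0 = linv k a }ᶜ ∩ { y | cons k a y.1 i = b }) := by
    ext y
    by_cases h : y.1 0 = linv k a <;> simp [letterAct, h, shift]
  rw [this]
  refine ((measurableSet_coord _ _).inter (measurableSet_coord _ _)).union
    ((measurableSet_coord _ _).compl.inter ?_)
  cases i with
  | zero => exact MeasurableSet.const (a = b)
  | succ i => exact measurableSet_coord i b

instance : MeasurableConstSMul (F k) (Boundary k) where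
  measurable_const_smul u := by
    obtain ⟨l, rfl⟩ : ∃ l, FreeGroup.mk l = u := ⟨_, FreeGroup.mk_toWord⟩
    induction l with
    | nil => simpa [← FreeGroup.one_eq_mk] using! measurable_id
    | cons a l ih =>
      have : (fun x : Boundary k => (FreeGroup.mk (a :: l) : F k) • x) =
          letterAct a ∘ fun x => (FreeGroup.mk l : F k) • x := by
        funext x
        rw [← el_mul_mk, mul_smul, FGC.el_smul]
        rfl
      change Measurable (fun x : Boundary k => (FreeGroup.mk (a :: l) : F k) • x)
      rw [this]
      exact (measurable_letterAct a).comp ih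

theorem measurableSet_prefixEl (n : ℕ) (P : F k → Prop) :
    MeasurableSet { x : Boundary k | P (prefixEl k x n) } := by
  have : { x : Boundary k | P (prefixEl k x n) } =
      ⋃ w : { w : Fin n → L k // P (FreeGroup.mk (List.ofFn w)) },
        ⋂ i : Fin n, { x : Boundary k | x.1 i = w.1 i } := by
    ext x
    simp only [Set.mem_ofPred_eq, Set.mem_iUnion, Set.mem_iInter]
    constructor
    · intro h
      exact ⟨⟨fun i => x.1 i, h⟩, fun i => rfl⟩
    · rintro ⟨⟨w, hw⟩, h⟩
      have : w = fun i : Fin n => x.1 i := funext fun i => (h i).symm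
      rwa [this] at hw
  rw [this]
  exact MeasurableSet.iUnion fun w => MeasurableSet.iInter fun i => measurableSet_coord _ _

theorem IsBdryExt.measurable {Φ : F k ≃* F k} {b : Boundary k → Boundary k}
    (h : IsBdryExt k Φ b) : Measurable b := by
  apply measurable_of_coord
  intro i a
  have : { x : Boundary k | (b x).1 i = a } =
      ⋃ N : ℕ, ⋂ n : ℕ, { x | N ≤ n → (Φ (prefixEl k x n)).toWord[i]? = some a } := by
    ext x
    simp only [Set.mem_ofPred_eq, Set.mem_iUnion, Set.mem_iInter]
    rw [← eventually_atTop]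
    constructor
    · rintro rfl
      exact h.rayTendsto x i
    · intro h'
      obtain ⟨n, hn, hn'⟩ := ((h.rayTendsto x i).and h').exists
      rw [hn] at hn'
      exact Option.some.inj hn'
  rw [this]
  exact MeasurableSet.iUnion fun N => MeasurableSet.iInter fun n =>
    measurableSet_prefixEl n fun g => N ≤ n → (Φ g).toWord[i]? = some a

theorem mem_Cyl2_iff {x y : F k} {p : Boundary k × Boundary k} :
    p ∈ Cyl2 k x y ↔ (x⁻¹ • p.1).1 0 ≠ (x⁻¹ • p.2).1 0 ∧
      x⁻¹ • p.2 ∈ listCyl (x⁻¹ * y).toWord := by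
  rw [← Cyl_eq_listCyl]
  constructor
  · rintro ⟨q, hq, rfl⟩
    change (x⁻¹ • x • q.1).1 0 ≠ (x⁻¹ • x • q.2).1 0 ∧ x⁻¹ • x • q.2 ∈ _
    rwa [inv_smul_smul, inv_smul_smul]
  · intro h
    refine ⟨(x⁻¹ • p.1, x⁻¹ • p.2), h, ?_⟩
    change (x • x⁻¹ • p.1, x • x⁻¹ • p.2) = _
    rw [smul_inv_smul, smul_inv_smul]

theorem isReduced_invRev_append {z : L k} {s t w : List (L k)}
    (hs : FreeGroup.IsReduced (z :: s)) (ht : FreeGroup.IsReduced (z :: t))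
    (hw : FreeGroup.IsReduced (linv k z :: (w ++ [z]))) :
    FreeGroup.IsReduced (FreeGroup.invRev (z :: s) ++ (w ++ z :: t)) := by
  have h1 : FreeGroup.IsReduced (FreeGroup.invRev s ++ [linv k z]) := by
    have : FreeGroup.IsReduced (FreeGroup.invRev (z :: s)) := by
      rw [FreeGroup.isReduced_iff_reduce_eq, FreeGroup.reduce_invRev, hs.reduce_eq]
    simpa [FreeGroup.invRev, linv] using this
  have h2 := h1.append_overlap (L₃ := w ++ [z]) (by simpa using hw) (by simp)
  have h3 := FreeGroup.IsReduced.append_overlap (L₁ := FreeGroup.invRev s ++ [linv k z] ++ w)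
    (L₂ := [z]) (L₃ := t) (by simpa using h2) (by simpa using ht) (by simp)
  simpa [FreeGroup.invRev, linv] using h3

theorem Cyl2_eq_prod {z : L k} {s t w : List (L k)}
    (hs : FreeGroup.IsReduced (z :: s)) (ht : FreeGroup.IsReduced (z :: t))
    (hw : FreeGroup.IsReduced (linv k z :: (w ++ [z]))) :
    Cyl2 k (FreeGroup.mk (z :: s)) (FreeGroup.mk (w ++ z :: t)) =
      { p | p.1 ∈ listCyl (z :: s) ∧ (FreeGroup.mk w : F k)⁻¹ • p.2 ∈ listCyl (z :: t) } := by
  have hred := isReduced_invRev_append hs ht hw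
  ext ⟨p, q⟩
  rw [mem_Cyl2_iff]
  have hx : (FreeGroup.mk (z :: s))⁻¹ * FreeGroup.mk (w ++ z :: t) =
      (FreeGroup.mk (FreeGroup.invRev (z :: s) ++ (w ++ z :: t)) : F k) := by
    rw [FreeGroup.inv_mk, FreeGroup.mul_mk]
  rw [hx, toWord_mk_of_isReduced hred]
  have hq : (FreeGroup.mk (z :: s) : F k)⁻¹ • q ∈
      listCyl (FreeGroup.invRev (z :: s) ++ (w ++ z :: t)) ↔
      (FreeGroup.mk w : F k)⁻¹ • q ∈ listCyl (z :: t) := by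
    rw [FreeGroup.inv_mk, mk_smul_mem_listCyl_append (by simp) hred,
      ← mk_smul_mem_listCyl_append (x := (FreeGroup.mk w : F k)⁻¹ • q) (by simp)
        (List.IsChain.right_of_append hred), smul_inv_smul]
  obtain ⟨u, e, hu⟩ := List.eq_nil_or_concat' (z :: s) |>.resolve_left (by simp)
  have hp : p ∈ listCyl (z :: s) ↔ ((FreeGroup.mk (z :: s) : F k)⁻¹ • p).1 0 ≠ linv k e := by
    have h := mk_smul_mem_listCyl_concat (hu ▸ hs) (x := (FreeGroup.mk (z :: s) : F k)⁻¹ • p)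
    rwa [← hu, smul_inv_smul] at h
  have hhead : ∀ x ∈ listCyl (FreeGroup.invRev (z :: s) ++ (w ++ z :: t)),
      x.1 0 = linv k e := by
    intro x hx
    rw [hu] at hx
    have := hx 0 (by simp)
    simpa [FreeGroup.invRev, linv] using this
  change (_ ∧ _) ↔ p ∈ _ ∧ _ • q ∈ _
  rw [hp, ← hq]
  constructor
  · rintro ⟨h1, h2⟩
    rw [hhead _ h2] at h1
    exact ⟨h1, h2⟩
  · rintro ⟨h1, h2⟩
    refine ⟨?_, h2⟩
    rw [hhead _ h2]
    exact h1

/-- The measure of a nonempty cylinder of length `n`. -/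
def cylMass (k n : ℕ) : ℝ≥0∞ := ((2 * k : ℝ≥0∞) * (2 * k - 1) ^ (n - 1))⁻¹

theorem two_mul_sub_one_ne_zero (hk : 2 ≤ k) : (2 * k - 1 : ℝ≥0∞) ≠ 0 := by
  refine (tsub_pos_of_lt ?_).ne'
  have : (1 : ℝ≥0∞) < ((2 * k : ℕ) : ℝ≥0∞) := by exact_mod_cast (by omega : 1 < 2 * k)
  simpa using this

theorem two_mul_sub_one_ne_top : (2 * k - 1 : ℝ≥0∞) ≠ ⊤ :=
  ENNReal.sub_ne_top (ENNReal.mul_ne_top (by simp) (by simp))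

theorem cylMass_ne_zero (n : ℕ) : cylMass k n ≠ 0 :=
  ENNReal.inv_ne_zero.2 (ENNReal.mul_ne_top (ENNReal.mul_ne_top (by simp) (by simp))
    (ENNReal.pow_ne_top two_mul_sub_one_ne_top))

theorem exists_cylMass_add (hk : 2 ≤ k) (r : ℕ) :
    ∃ c : ℝ≥0∞, c ≠ 0 ∧ c ≠ ⊤ ∧ ∀ m n : ℕ,
      cylMass k ((m + 1) + (r + (n + 1))) = c * cylMass k (m + 1) * cylMass k (n + 1) := by
  set a : ℝ≥0∞ := 2 * k with ha
  set b : ℝ≥0∞ := a - 1 with hb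
  have ha0 : a ≠ 0 := by
    rw [ha]
    have : (k : ℝ≥0∞) ≠ 0 := by exact_mod_cast (by omega : k ≠ 0)
    exact mul_ne_zero (by simp) this
  have hat : a ≠ ⊤ := ENNReal.mul_ne_top (by simp) (by simp)
  have hb0 : b ≠ 0 := two_mul_sub_one_ne_zero hk
  have hbt : b ≠ ⊤ := two_mul_sub_one_ne_top
  refine ⟨a * (b ^ (r + 1))⁻¹, mul_ne_zero ha0 (ENNReal.inv_ne_zero.2 (ENNReal.pow_ne_top hbt)),
    ENNReal.mul_ne_top hat (ENNReal.inv_ne_top.2 (pow_ne_zero _ hb0)), fun m n => ?_⟩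
  have h : ∀ j, cylMass k (j + 1) = a⁻¹ * (b ^ j)⁻¹ := fun j => by
    rw [cylMass, ENNReal.mul_inv (Or.inl ha0) (Or.inl hat)]
    rfl
  rw [show (m + 1) + (r + (n + 1)) = ((r + 1) + m + n) + 1 by ring, h, h, h, pow_add, pow_add,
    ENNReal.mul_inv (Or.inr (ENNReal.pow_ne_top hbt)) (Or.inr (pow_ne_zero _ hb0)),
    ENNReal.mul_inv (Or.inr (ENNReal.pow_ne_top hbt)) (Or.inr (pow_ne_zero _ hb0))]
  calc _ = (a * a⁻¹) * (a⁻¹ * ((b ^ (r + 1))⁻¹ * (b ^ m)⁻¹ * (b ^ n)⁻¹)) := by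
        rw [ENNReal.mul_inv_cancel ha0 hat, one_mul]
    _ = _ := by ring

theorem listCyl_inter_singleton (l : List (L k)) (z : L k) :
    listCyl l ∩ listCyl [z] = ∅ ∨
      ∃ s, FreeGroup.IsReduced (z :: s) ∧ listCyl l ∩ listCyl [z] = listCyl (z :: s) := by
  rcases Set.eq_empty_or_nonempty (listCyl l ∩ listCyl [z]) with h | ⟨x, hx, hxz⟩
  · exact Or.inl h
  right
  rw [mem_listCyl_singleton] at hxz
  cases l with
  | nil =>
    refine ⟨[], FreeGroup.isReduced_iff_reduce_eq.2 rfl, ?_⟩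
    ext y
    simp [listCyl]
  | cons a l =>
    have ha := (mem_listCyl_cons.1 hx).1
    obtain rfl : a = z := ha.symm.trans hxz
    refine ⟨l, ?_, ?_⟩
    · have : (a :: l) = List.ofFn fun i : Fin (a :: l).length => x.1 i := by
        apply List.ext_getElem (by simp)
        intro i h1 h2
        rw [List.getElem_ofFn, hx i h1]
      rw [this]
      exact isReduced_ofFn x _
    · refine Set.inter_eq_left.2 fun y hy => ?_
      rw [mem_listCyl_singleton]
      exact (mem_listCyl_cons.1 hy).1

/-- The uniform current has product structure on products of a cylinder with its translate. -/
theorem exists_current_prod_eq (hk : 2 ≤ k) {μA : Measure (Boundary k)} [IsProbabilityMeasure μA]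
    (hμA : ∀ v : F k, v ≠ 1 →
      μA (Cyl k v) = ((2 * k : ℝ≥0∞) * (2 * k - 1) ^ (wordLength k v - 1))⁻¹)
    {ηA : Measure (Boundary k × Boundary k)}
    (hηA' : ∀ x y : F k, ηA (Cyl2 k x y) = μA (Cyl k (x⁻¹ * y)))
    {z : L k} {w : List (L k)} (hw : FreeGroup.IsReduced (linv k z :: (w ++ [z]))) :
    ∃ c : ℝ≥0∞, c ≠ 0 ∧ ∀ V W : Set (Boundary k), MeasurableSet V → MeasurableSet W →
      V ⊆ listCyl [z] → W ⊆ listCyl [z] →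
      ηA { p | p.1 ∈ V ∧ (FreeGroup.mk w : F k)⁻¹ • p.2 ∈ W } = c * μA V * μA W := by
  obtain ⟨c, hc0, hct, hc⟩ := exists_cylMass_add hk w.length
  refine ⟨c, hc0, fun V W hV hW hVz hWz => ?_⟩
  have hmass : ∀ l : List (L k), l ≠ [] → FreeGroup.IsReduced l →
      μA (listCyl l) = cylMass k l.length := by
    intro l hl hred
    have h := hμA (FreeGroup.mk l) (by
      rw [Ne, ← FreeGroup.toWord_eq_nil_iff, toWord_mk_of_isReduced hred]
      exact hl)
    rwa [Cyl_eq_listCyl, wordLength, toWord_mk_of_isReduced hred] at h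
  set T : Boundary k × Boundary k → Boundary k × Boundary k :=
    fun p => (p.1, (FreeGroup.mk w : F k)⁻¹ • p.2) with hT
  have hTm : Measurable T := measurable_fst.prodMk
    ((measurable_const_smul ((FreeGroup.mk w : F k)⁻¹)).comp measurable_snd)
  have hz := measurableSet_listCyl [z]
  have hprod : (μA.restrict (listCyl [z])).prod (c • μA.restrict (listCyl [z])) =
      (ηA.map T).restrict (listCyl [z] ×ˢ listCyl [z]) := by
    have : IsFiniteMeasure (c • μA.restrict (listCyl [z])) := Measure.smul_finite _ hct
    refine Measure.prod_eq_generateFrom generateFrom_listCyl generateFrom_listCyl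
      isPiSystem_listCyl isPiSystem_listCyl
      ⟨fun _ => Set.univ, fun _ => ⟨[], by simp [listCyl]⟩, fun _ => measure_lt_top _ _,
        Set.iUnion_const _⟩
      ⟨fun _ => Set.univ, fun _ => ⟨[], by simp [listCyl]⟩, fun _ => measure_lt_top _ _,
        Set.iUnion_const _⟩ ?_
    rintro _ ⟨l, rfl⟩ _ ⟨l', rfl⟩
    have hl := measurableSet_listCyl l
    have hl' := measurableSet_listCyl l'
    rw [Measure.restrict_apply (hl.prod hl'), Set.prod_inter_prod, Measure.smul_apply,
      Measure.restrict_apply hl, Measure.restrict_apply hl', smul_eq_mul,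
      Measure.map_apply hTm ((hl.inter hz).prod (hl'.inter hz))]
    rcases listCyl_inter_singleton l z with h | ⟨s, hs, h⟩
    · simp [h]
    rcases listCyl_inter_singleton l' z with h' | ⟨t, ht, h'⟩
    · simp [h']
    have h1 := hηA' (FreeGroup.mk (z :: s)) (FreeGroup.mk (w ++ z :: t))
    have hred := isReduced_invRev_append hs ht hw
    rw [Cyl2_eq_prod hs ht hw, FreeGroup.inv_mk (L := z :: s), FreeGroup.mul_mk, Cyl_eq_listCyl,
      toWord_mk_of_isReduced hred, hmass _ (by simp) hred, List.length_append,
      FreeGroup.invRev_length, List.length_append, List.length_cons, List.length_cons, hc] at h1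
    rw [h, h', hmass _ (by simp) hs, hmass _ (by simp) ht, List.length_cons, List.length_cons]
    refine Eq.trans h1 ?_
    ring
  have h := congrArg (fun m : Measure (Boundary k × Boundary k) => m (V ×ˢ W)) hprod
  rw [Measure.prod_prod, Measure.restrict_apply (hV.prod hW), Set.prod_inter_prod,
    Measure.smul_apply, Measure.restrict_apply hV, Measure.restrict_apply hW,
    Set.inter_eq_left.2 hVz, Set.inter_eq_left.2 hWz, Measure.map_apply hTm (hV.prod hW)] at h
  refine Eq.trans h.symm ?_
  rw [smul_eq_mul]
  ring

/-- A bi-infinite geodesic of the Cayley graph, with vertices `v j` and edge labels `l j`, on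
which `h` acts as the translation by `N`. -/
structure IsAxis (h : F k) (N : ℕ) (v : ℤ → F k) (l : ℤ → L k) : Prop where
  vertex_succ : ∀ j, v (j + 1) = v j * el k (l j)
  label_succ_ne : ∀ j, l (j + 1) ≠ linv k (l j)
  vertex_add : ∀ j, v (j + N) = h * v j
  label_add : ∀ j, l (j + N) = l j

/-- The rays on the positive side of the `j`-th edge of a bi-infinite geodesic. -/
def halfSpace (v : ℤ → F k) (l : ℤ → L k) (j : ℤ) : Set (Boundary k) :=
  { ξ | ((v j)⁻¹ • ξ).1 0 = l j }

section Axis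

variable {h : F k} {N : ℕ} {v : ℤ → F k} {l : ℤ → L k}

theorem IsAxis.inv_succ_smul (hA : IsAxis h N v l) (j : ℤ) (ξ : Boundary k) :
    (v (j + 1))⁻¹ • ξ = el k (linv k (l j)) • (v j)⁻¹ • ξ := by
  rw [hA.vertex_succ, mul_inv_rev, mul_smul, el_linv]

theorem IsAxis.mem_halfSpace_iff (hA : IsAxis h N v l) {j : ℤ} {ξ : Boundary k} :
    ξ ∈ halfSpace v l j ↔ ((v (j + 1))⁻¹ • ξ).1 0 ≠ linv k (l j) := by
  rw [hA.inv_succ_smul, Ne, el_smul_head_eq_iff, linv_linv, not_not]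
  rfl

theorem IsAxis.antitone_halfSpace (hA : IsAxis h N v l) : Antitone (halfSpace v l) := by
  refine antitone_int_of_succ_le fun j ξ hξ => ?_
  rw [hA.mem_halfSpace_iff]
  have : ((v (j + 1))⁻¹ • ξ).1 0 = l (j + 1) := hξ
  rw [this]
  exact hA.label_succ_ne j

theorem IsAxis.reverse (hA : IsAxis h N v l) :
    IsAxis h⁻¹ N (fun j => v (-j)) (fun j => linv k (l (-j - 1))) where
  vertex_succ j := by
    have := hA.vertex_succ (-j - 1)
    rw [sub_add_cancel] at this
    rw [this, el_linv, mul_inv_cancel_right, neg_add']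
  label_succ_ne j e := by
    have := hA.label_succ_ne (-(j + 1) - 1)
    rw [linv_linv] at e
    rw [e, sub_add_cancel, neg_add'] at this
    exact this rfl
  vertex_add j := by
    have := hA.vertex_add (-(j + N))
    rw [show -(j + N) + N = -j by ring] at this
    rw [this, inv_mul_cancel_left]
  label_add j := by
    have := hA.label_add (-(j + N) - 1)
    rw [show -(j + N) - 1 + N = -j - 1 by ring] at this
    rw [this]

theorem IsAxis.mem_halfSpace_reverse_iff (hA : IsAxis h N v l) {j : ℤ} {ξ : Boundary k} :
    ξ ∈ halfSpace (fun j => v (-j)) (fun j => linv k (l (-j - 1))) j ↔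
      ξ ∉ halfSpace v l (-j - 1) := by
  rw [hA.mem_halfSpace_iff, sub_add_cancel, not_not]
  rfl

theorem IsAxis.mem_halfSpace_add_iff (hA : IsAxis h N v l) {j : ℤ} {ξ : Boundary k} :
    ξ ∈ halfSpace v l (j + N) ↔ h⁻¹ • ξ ∈ halfSpace v l j := by
  change ((v (j + N))⁻¹ • ξ).1 0 = l (j + N) ↔ ((v j)⁻¹ • h⁻¹ • ξ).1 0 = l j
  rw [hA.vertex_add, hA.label_add, mul_inv_rev, mul_smul]

theorem IsAxis.eq_of_forall_mem (hA : IsAxis h N v l) {ξ ξ' : Boundary k}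
    (hξ : ∀ j, ξ ∈ halfSpace v l j) (hξ' : ∀ j, ξ' ∈ halfSpace v l j) : ξ = ξ' := by
  have key : ∀ ζ : Boundary k, (∀ j, ζ ∈ halfSpace v l j) → ∀ n : ℕ,
      ((v 0)⁻¹ • ζ).1 n = l n := by
    intro ζ hζ n
    have hs : ∀ n m : ℕ, ((v n)⁻¹ • ζ).1 m = ((v 0)⁻¹ • ζ).1 (n + m) := by
      intro n
      induction n with
      | zero => intro m; simp
      | succ n ih =>
        intro m
        have h0 : ((v n)⁻¹ • ζ).1 0 = linv k (linv k (l n)) := by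
          rw [linv_linv]
          exact hζ n
        rw [Nat.cast_succ, hA.inv_succ_smul, el_smul_val_of_eq h0, shift, ih, add_assoc n 1 m,
          add_comm 1 m]
    rw [← add_zero n, ← hs n 0]
    exact hζ n
  have : (v 0)⁻¹ • ξ = (v 0)⁻¹ • ξ' :=
    Subtype.ext (funext fun n => (key ξ hξ n).trans (key ξ' hξ' n).symm)
  exact smul_left_cancel _ this

theorem IsAxis.smul_eq_of_forall_mem (hA : IsAxis h N v l) {ξ : Boundary k}
    (hξ : ∀ j, ξ ∈ halfSpace v l j) : h • ξ = ξ := by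
  refine hA.eq_of_forall_mem (fun j => ?_) hξ
  rw [← sub_add_cancel j (N : ℤ), hA.mem_halfSpace_add_iff, inv_smul_smul]
  exact hξ _

theorem IsAxis.smul_eq_of_forall_notMem (hA : IsAxis h N v l) {ξ : Boundary k}
    (hξ : ∀ j, ξ ∉ halfSpace v l j) : h • ξ = ξ := by
  have := hA.reverse.smul_eq_of_forall_mem (ξ := ξ) fun j =>
    hA.mem_halfSpace_reverse_iff.2 (hξ _)
  rwa [inv_smul_eq_iff, eq_comm] at this

theorem exists_letter_ne (hk : 2 ≤ k) (a b : L k) : ∃ z : L k, z ≠ a ∧ z ≠ b := by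
  have : ({a, b} : Finset (L k)).card < Fintype.card (L k) := by
    have := Finset.card_le_two (a := a) (b := b)
    simp only [Fintype.card_prod, Fintype.card_fin, Fintype.card_bool]
    omega
  obtain ⟨z, hz⟩ := Finset.exists_mem_notMem_of_card_lt_card (s := {a, b}) (t := Finset.univ)
    (by simpa using this)
  exact ⟨z, by simpa [not_or] using hz⟩

/-- The ray repeating a letter. -/
def constRay (a : L k) : Boundary k :=
  ⟨fun _ => a, fun _ h => by simpa [linv] using congrArg Prod.snd h⟩

theorem IsAxis.vertex_ne (hA : IsAxis h N v l) (hk : 2 ≤ k) {i j : ℤ} (hij : i < j) :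
    v i ≠ v j := by
  intro e
  obtain ⟨z, hz, hz'⟩ := exists_letter_ne hk (l i) (linv k (l (j - 1)))
  have h1 : v j • constRay z ∈ halfSpace v l (j - 1) := by
    rw [hA.mem_halfSpace_iff, sub_add_cancel, inv_smul_smul]
    exact hz'
  have h2 : ((v i)⁻¹ • v j • constRay z).1 0 = l i := hA.antitone_halfSpace (by omega) h1
  rw [e, inv_smul_smul] at h2
  exact hz h2

theorem IsAxis.vertex_injective (hA : IsAxis h N v l) (hk : 2 ≤ k) : Function.Injective v := by
  intro i j e
  rcases lt_trichotomy i j with hij | rfl | hij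
  · exact (hA.vertex_ne hk hij e).elim
  · rfl
  · exact (hA.vertex_ne hk hij e.symm).elim

/-- The first letters of two rays separated by the `j`-th edge differ. -/
theorem head_ne_of_halfSpace {j : ℤ} {ξ ξ' : Boundary k}
    (hξ : ξ ∉ halfSpace v l j) (hξ' : ξ' ∈ halfSpace v l j) :
    ((v j)⁻¹ • ξ).1 0 ≠ ((v j)⁻¹ • ξ').1 0 := fun e => hξ (e.trans hξ')

theorem measurableSet_halfSpace (v : ℤ → F k) (l : ℤ → L k) (j : ℤ) :
    MeasurableSet (halfSpace v l j) :=
  measurable_const_smul ((v j)⁻¹) (measurableSet_coord 0 (l j))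

end Axis

theorem cyclLength_le (h g : F k) : cyclLength k h ≤ (g * h * g⁻¹).toWord.length :=
  Nat.sInf_le ⟨g, rfl⟩

theorem conjugator_mul_reduceCyclically (f : F k) :
    FreeGroup.mk (FreeGroup.reduceCyclically.conjugator f.toWord) *
      FreeGroup.mk (FreeGroup.reduceCyclically f.toWord) *
      (FreeGroup.mk (FreeGroup.reduceCyclically.conjugator f.toWord))⁻¹ = f := by
  rw [FreeGroup.inv_mk, FreeGroup.mul_mk, FreeGroup.mul_mk,
    FreeGroup.reduceCyclically.conj_conjugator_reduceCyclically, FreeGroup.mk_toWord]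

theorem exists_isAxis {h : F k} (hh : h ≠ 1) :
    ∃ N v l, cyclLength k h ≤ N ∧ IsAxis h N v l := by
  set w := FreeGroup.reduceCyclically h.toWord
  set c : F k := FreeGroup.mk (FreeGroup.reduceCyclically.conjugator h.toWord)
  have hconj : c * FreeGroup.mk w * c⁻¹ = h := conjugator_mul_reduceCyclically h
  have hcyc : FreeGroup.IsCyclicallyReduced w :=
    FreeGroup.reduceCyclically.isCyclicallyReduced FreeGroup.isReduced_toWord
  have hw0 : w ≠ [] := by
    rintro e
    rw [e, ← FreeGroup.one_eq_mk, mul_one, mul_inv_cancel] at hconj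
    exact hh hconj.symm
  have hN : 0 < w.length := List.length_pos_iff.2 hw0
  have hNz : (0 : ℤ) < w.length := by exact_mod_cast hN
  have hlt : ∀ j : ℤ, (j % w.length).toNat < w.length := fun j => by
    have h1 := Int.emod_lt_of_pos j hNz
    have h2 := Int.emod_nonneg j hNz.ne'
    omega
  have hcase : ∀ j : ℤ,
      ((j % w.length).toNat + 1 < w.length ∧
        ((j + 1) % w.length).toNat = (j % w.length).toNat + 1 ∧
        (j + 1) / w.length = j / w.length) ∨
      ((j % w.length).toNat + 1 = w.length ∧ ((j + 1) % w.length).toNat = 0 ∧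
        (j + 1) / w.length = j / w.length + 1) := by
    intro j
    have h1 := Int.emod_lt_of_pos j hNz
    have h2 := Int.emod_nonneg j hNz.ne'
    have h3 := Int.mul_ediv_add_emod j w.length
    rcases lt_or_ge (j % w.length + 1) w.length with h4 | h4
    · left
      obtain ⟨h5, h6⟩ := (Int.ediv_emod_unique (a := j + 1) (r := j % w.length + 1)
        (q := j / w.length) hNz).2 ⟨by linarith, by omega, h4⟩
      rw [h5, h6]
      omega
    · right
      obtain ⟨h5, h6⟩ := (Int.ediv_emod_unique (a := j + 1) (r := 0)
        (q := j / w.length + 1) hNz).2 ⟨by rw [mul_add]; omega, le_rfl, hNz⟩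
      rw [h5, h6]
      omega
  refine ⟨w.length, fun j => c * FreeGroup.mk w ^ (j / w.length) *
    FreeGroup.mk (w.take (j % w.length).toNat), fun j => w[(j % w.length).toNat]'(hlt j),
    ?_, ?_, ?_, ?_, ?_⟩
  · refine (cyclLength_le h c⁻¹).trans ?_
    rw [← hconj]
    simp only [mul_assoc, inv_mul_cancel_left, inv_inv, inv_mul_cancel, mul_one]
    rw [toWord_mk_of_isReduced hcyc.isReduced]
  · intro j
    have hel : FreeGroup.mk (w.take (j % w.length).toNat) * el k (w[(j % w.length).toNat]'(hlt j))
        = FreeGroup.mk (w.take ((j % w.length).toNat + 1)) := by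
      rw [el, FreeGroup.mul_mk, List.take_append_getElem]
    rw [mul_assoc (_ * _) (FreeGroup.mk _) (el k _), hel]
    rcases hcase j with ⟨h1, h2, h3⟩ | ⟨h1, h2, h3⟩
    · rw [h2, h3]
    · rw [h2, h3, h1, zpow_add_one]
      simp [← FreeGroup.one_eq_mk, mul_assoc]
  · intro j
    rcases hcase j with ⟨h1, h2, h3⟩ | ⟨h1, h2, h3⟩
    · simp only [h2]
      exact isReduced_rel_iff.1 (List.isChain_iff_getElem.1 hcyc.isReduced _ h1)
    · simp only [h2]
      have hlast := (FreeGroup.isCyclicallyReduced_iff.1 hcyc).2 (w[(j % w.length).toNat]'(hlt j))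
        (by rw [List.getLast?_eq_getElem?, show w.length - 1 = (j % w.length).toNat by omega,
          List.getElem?_eq_getElem (hlt j)]; rfl) w[0] (by
          rw [List.head?_eq_getElem?, List.getElem?_eq_getElem hN]; rfl)
      exact isReduced_rel_iff.1 hlast
  · intro j
    rw [Int.add_ediv_of_dvd_right dvd_rfl, Int.ediv_self hNz.ne', Int.add_emod_right,
      zpow_add_one, ← hconj]
    have := (Commute.refl (FreeGroup.mk w : F k)).zpow_right (j / w.length)
    rw [← this.eq]
    simp only [mul_assoc, inv_mul_cancel_left]
  · intro j
    simp only [Int.add_emod_right]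

theorem card_mul_measure_le {η : Measure (Boundary k × Boundary k)} (hη : IsCurrent k η)
    {A R R' : Set (Boundary k × Boundary k)} (hA : η A ≠ ⊤)
    (hR : MeasurableSet R) (hR' : MeasurableSet R')
    (hRR' : ∀ p ∈ R, ∀ q ∈ R', p.1.1 0 ≠ q.1.1 0 ∧ q.1.1 0 ≠ p.2.1 0 ∧ p.1.1 0 ≠ p.2.1 0)
    (s : Finset (F k)) (hs : ∀ g ∈ s, actPair k g ⁻¹' R ⊆ A ∧ actPair k g ⁻¹' R' ⊆ A) :
    s.card * (η R * η R') ≤ η A * η A := by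
  have hact : ∀ g : F k, Measurable (actPair k g) := fun g =>
    ((measurable_const_smul g).comp measurable_fst).prodMk
      ((measurable_const_smul g).comp measurable_snd)
  have : IsFiniteMeasure (η.restrict A) := isFiniteMeasure_restrict.2 hA
  set ν := (η.restrict A).prod (η.restrict A) with hν
  set Q : F k → Set ((Boundary k × Boundary k) × (Boundary k × Boundary k)) :=
    fun g => (actPair k g ⁻¹' R) ×ˢ (actPair k g ⁻¹' R') with hQ
  have hval : ∀ g ∈ s, ν (Q g) = η R * η R' := by
    intro g hg
    rw [hν, hQ, Measure.prod_prod, Measure.restrict_apply (hact g hR),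
      Measure.restrict_apply (hact g hR'), Set.inter_eq_left.2 (hs g hg).1,
      Set.inter_eq_left.2 (hs g hg).2, hη.2.1 g _ hR, hη.2.1 g _ hR']
  have hdisj : (s : Set (F k)).PairwiseDisjoint Q := by
    intro g _ g' _ hne
    refine Set.disjoint_left.2 ?_
    rintro ⟨p, q⟩ ⟨h1, h2⟩ ⟨h3, h4⟩
    obtain ⟨a1, a2, a3⟩ := hRR' _ h1 _ h2
    obtain ⟨b1, b2, b3⟩ := hRR' _ h3 _ h4
    have hx : ∀ x : Boundary k, (g' * g⁻¹) • g • x = g' • x := fun x => by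
      rw [mul_smul, inv_smul_smul]
    have := eq_one_of_smul_triple (g := g' * g⁻¹) (x := g • p.1) (y := g • q.1) (z := g • p.2)
      a1 a2 a3 (by rw [hx, hx]; exact b1) (by rw [hx, hx]; exact b2) (by rw [hx, hx]; exact b3)
    exact hne (mul_inv_eq_one.1 this).symm
  calc s.card * (η R * η R') = ∑ g ∈ s, ν (Q g) := by
        rw [Finset.sum_congr rfl hval, Finset.sum_const, nsmul_eq_mul]
    _ = ν (⋃ g ∈ s, Q g) :=
        (measure_biUnion_finset hdisj fun g _ => (hact g hR).prod (hact g hR')).symm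
    _ ≤ ν Set.univ := measure_mono (Set.subset_univ _)
    _ = η A * η A := by
        rw [hν, ← Set.univ_prod_univ, Measure.prod_prod, Measure.restrict_apply_univ]

/-- A decreasing family exhausting `U` in both directions has a median. -/
theorem exists_median {X : Type*} [MeasurableSpace X] {μ : Measure X} [IsFiniteMeasure μ]
    {U : Set X} {H : ℤ → Set X} (hU : MeasurableSet U) (hH : ∀ j, MeasurableSet (H j))
    (hanti : Antitone H) (h1 : ∀ x ∈ U, ∃ j, x ∉ H j) (h2 : ∀ x ∈ U, ∃ j, x ∈ H j)
    (hpos : μ U ≠ 0) :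
    ∃ i, μ U / 2 ≤ μ (U ∩ H i) ∧ μ U / 2 ≤ μ (U \ H (i + 1)) := by
  have hanti' : Antitone fun j => U ∩ H j := fun i j hij =>
    Set.inter_subset_inter_right _ (hanti hij)
  have hUt : μ U ≠ ⊤ := measure_ne_top _ _
  have hlt : μ U / 2 < μ U := ENNReal.half_lt_self hpos hUt
  have hbot : Tendsto (fun j => μ (U ∩ H j)) atBot (𝓝 (μ U)) := by
    have h := tendsto_measure_iUnion_atBot (μ := μ) hanti'
    rwa [← Set.inter_iUnion, Set.inter_eq_left.2 fun x hx => Set.mem_iUnion.2 (h2 x hx)] at h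
  have htop : Tendsto (fun j => μ (U ∩ H j)) atTop (𝓝 0) := by
    have h := tendsto_measure_iInter_atTop (μ := μ)
      (fun j => (hU.inter (hH j)).nullMeasurableSet) hanti' ⟨0, measure_ne_top _ _⟩
    rwa [show ⋂ j, U ∩ H j = ∅ from ?_, measure_empty] at h
    refine Set.eq_empty_of_forall_notMem fun x hx => ?_
    rw [Set.mem_iInter] at hx
    obtain ⟨j, hj⟩ := h1 x (hx 0).1
    exact hj (hx j).2
  obtain ⟨a, ha⟩ := (hbot.eventually (lt_mem_nhds hlt)).exists
  obtain ⟨c, hc⟩ := (htop.eventually (gt_mem_nhds (ENNReal.half_pos hpos))).exists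
  obtain ⟨i, hi, himax⟩ := Int.exists_greatest_of_bdd (P := fun j => μ U / 2 ≤ μ (U ∩ H j))
    ⟨c, fun j hj => by
      by_contra! hcj
      exact absurd (hj.trans (measure_mono (hanti' hcj.le))) hc.not_ge⟩ ⟨a, ha.le⟩
  refine ⟨i, hi, ?_⟩
  have hlow : μ (U ∩ H (i + 1)) ≤ μ U / 2 := by
    by_contra! h
    have := himax _ h.le
    omega
  have hsum := measure_inter_add_sdiff (μ := μ) U (hH (i + 1))
  rw [← ENNReal.add_halves (μ U)] at hsum
  by_contra! h
  exact hsum.not_lt (ENNReal.add_lt_add_of_le_of_lt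
    (measure_ne_top _ _) hlow h)

/-- The translation length of `Φ f` is controlled by the length of `Φ`, where `f` is given by its
action on the cylinder `U`. -/
theorem translation_mul_le {η : Measure (Boundary k × Boundary k)} (hη : IsCurrent k η)
    (hk : 2 ≤ k) {μ : Measure (Boundary k)} [IsFiniteMeasure μ]
    {f : F k} {z a a' : L k} (hza : z ≠ a) (hza' : z ≠ a') (haa' : a ≠ a')
    (hf : ∀ x ∈ listCyl [z], (f • x).1 0 = a) (hf' : ∀ x ∈ listCyl [z], (f⁻¹ • x).1 0 = a')
    {c c' : ℝ≥0∞}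
    (hc : ∀ V W : Set (Boundary k), MeasurableSet V → MeasurableSet W →
      V ⊆ listCyl [z] → W ⊆ listCyl [z] →
      η { p | p.1 ∈ V ∧ f⁻¹ • p.2 ∈ W } = c * μ V * μ W)
    (hc' : ∀ V W : Set (Boundary k), MeasurableSet V → MeasurableSet W →
      V ⊆ listCyl [z] → W ⊆ listCyl [z] →
      η { p | p.1 ∈ V ∧ (f * f)⁻¹ • p.2 ∈ W } = c' * μ V * μ W)
    (hpos : μ (listCyl [z]) ≠ 0)
    {Φ : MulAut (F k)} {b b' : Boundary k → Boundary k} (hb : IsBdryExt k Φ b)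
    (hb' : IsBdryExt k Φ⁻¹ b') (hfin : autLen k η b ≠ ⊤)
    {N : ℕ} {v : ℤ → F k} {l : ℤ → L k} (hA : IsAxis (Φ f) N v l) :
    N * (c * c' * (μ (listCyl [z]) / 2) ^ 4) ≤ autLen k η b * autLen k η b := by
  set U := listCyl [z] with hUdef
  have hU : MeasurableSet U := measurableSet_listCyl [z]
  have hinj : Function.Injective b := (hb.leftInverse hb').injective
  have hbm : Measurable b := hb.measurable
  have hmap : ∀ (u : F k) x, b (u • x) = Φ u • b x := hb.map_smul
  set H : ℤ → Set (Boundary k) := fun j => b ⁻¹' halfSpace v l j with hH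
  have hHm : ∀ j, MeasurableSet (H j) := fun j => hbm (measurableSet_halfSpace v l j)
  have hanti : Antitone H := fun i j hij => Set.preimage_mono (hA.antitone_halfSpace hij)
  have hnofix : ∀ x ∈ U, Φ f • b x ≠ b x := by
    intro x hx e
    rw [← hmap] at e
    have h1 := hf x hx
    rw [hinj e, mem_listCyl_singleton.1 hx] at h1
    exact hza h1
  obtain ⟨i, hhigh, hlow⟩ := exists_median hU hHm hanti
    (fun x hx => by
      by_contra! h
      exact hnofix x hx (hA.smul_eq_of_forall_mem h))
    (fun x hx => by
      by_contra! h
      exact hnofix x hx (hA.smul_eq_of_forall_notMem h)) hpos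
  have hshift : ∀ j x, x ∈ H (j + N) ↔ f⁻¹ • x ∈ H j := by
    intro j x
    change b x ∈ halfSpace v l (j + N) ↔ b (f⁻¹ • x) ∈ halfSpace v l j
    rw [hA.mem_halfSpace_add_iff, hmap, map_inv]
  set low := U \ H (i + 1) with hlowdef
  set high := U ∩ H i with hhighdef
  have hlowm : MeasurableSet low := hU.diff (hHm _)
  have hhighm : MeasurableSet high := hU.inter (hHm _)
  set R : Set (Boundary k × Boundary k) := { p | f • p.1 ∈ low ∧ f⁻¹ • p.2 ∈ high } with hR
  set R' : Set (Boundary k × Boundary k) := { p | p.1 ∈ low ∧ f⁻¹ • p.2 ∈ high } with hR'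
  have hRm : MeasurableSet R :=
    (((measurable_const_smul f).comp measurable_fst) hlowm).inter
      (((measurable_const_smul f⁻¹).comp measurable_snd) hhighm)
  have hRm' : MeasurableSet R' :=
    (measurable_fst hlowm).inter (((measurable_const_smul f⁻¹).comp measurable_snd) hhighm)
  have hηR' : η R' = c * μ low * μ high :=
    hc low high hlowm hhighm Set.sdiff_subset Set.inter_subset_left
  have hηR : η R = c' * μ low * μ high := by
    rw [← hc' low high hlowm hhighm Set.sdiff_subset Set.inter_subset_left]
    refine Eq.trans ?_ (hη.2.1 f _ ((measurable_fst hlowm).inter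
      (((measurable_const_smul (f * f)⁻¹).comp measurable_snd) hhighm)))
    congr 1
    ext p
    change _ ↔ f • p.1 ∈ low ∧ (f * f)⁻¹ • f • p.2 ∈ high
    rw [smul_smul (f * f)⁻¹, mul_inv_rev, inv_mul_cancel_right]
    rfl
  set A := pairMap k b ⁻¹' baseBall k with hAdef
  have hmemA : ∀ p, p ∈ A ↔ (b p.1).1 0 ≠ (b p.2).1 0 := by
    intro p
    refine ⟨fun h => h.1, fun h => ⟨h, ?_⟩⟩
    rw [Cyl_eq_listCyl, FreeGroup.toWord_one]
    intro j hj
    simp at hj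
  have hsub : ∀ j ∈ Finset.Icc (i + 1) (i + N), ∀ p : Boundary k × Boundary k,
      ((Φ.symm (v j)) • p.1 ∉ H (i + 1)) → f⁻¹ • (Φ.symm (v j)) • p.2 ∈ H i → p ∈ A := by
    intro j hj p hp hq
    rw [Finset.mem_Icc] at hj
    rw [← hshift] at hq
    have h1 := head_ne_of_halfSpace (fun h => hp (hanti hj.1 h)) (hanti hj.2 hq)
    rw [hmap, hmap, MulEquiv.apply_symm_apply, inv_smul_smul, inv_smul_smul] at h1
    exact (hmemA p).2 h1
  have hcard := card_mul_measure_le hη (A := A) hfin hRm hRm' (by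
      rintro p ⟨hp1, hp2⟩ q ⟨hq1, -⟩
      have e1 := hf' _ hp1.1
      have e2 := hf _ hp2.1
      have e3 := mem_listCyl_singleton.1 hq1.1
      rw [inv_smul_smul] at e1
      rw [smul_inv_smul] at e2
      rw [e1, e2, e3]
      exact ⟨hza'.symm, hza, haa'.symm⟩)
    ((Finset.Icc (i + 1) (i + N)).map
      ⟨fun j => Φ.symm (v j), Φ.symm.injective.comp (hA.vertex_injective hk)⟩) (by
      intro g hg
      obtain ⟨j, hj, rfl⟩ := Finset.mem_map.1 hg
      refine ⟨fun p hp => hsub j hj p ?_ hp.2.2, fun p hp => hsub j hj p hp.1.2 hp.2.2⟩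
      have h1 : f • Φ.symm (v j) • p.1 ∉ H (i + 1) := hp.1.2
      refine fun h => h1 (hanti (show i + 1 ≤ i + 1 + N by omega) ?_)
      rw [hshift, inv_smul_smul]
      exact h)
  rw [Finset.card_map, Int.card_Icc, show (i + N + 1 - (i + 1)).toNat = N by omega, hηR, hηR']
    at hcard
  refine le_trans (mul_le_mul_right ?_ _) hcard
  calc c * c' * (μ U / 2) ^ 4 = (c' * (μ U / 2) * (μ U / 2)) * (c * (μ U / 2) * (μ U / 2)) := by
        ring
    _ ≤ _ := by gcongr

theorem isReduced_linv_cons_append {z : L k} {w : List (L k)} (hw : FreeGroup.IsReduced w)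
    (hw0 : w ≠ []) (hhead : ∀ a ∈ w.head?, z ≠ a) (hlast : ∀ e ∈ w.getLast?, z ≠ linv k e) :
    FreeGroup.IsReduced (linv k z :: (w ++ [z])) := by
  rw [isReduced_cons_iff]
  constructor
  · intro b hb
    rw [List.head?_append_of_ne_nil _ hw0] at hb
    rw [linv_linv]
    exact (hhead b hb).symm
  · refine List.isChain_append.2 ⟨hw, List.isChain_singleton _, fun e he b hb => ?_⟩
    obtain rfl : z = b := by simpa using hb
    exact isReduced_rel_iff.2 (hlast e he)

theorem mk_smul_head {z a : L k} {w : List (L k)}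
    (hw : FreeGroup.IsReduced (a :: w ++ [z])) {x : Boundary k} (hx : x ∈ listCyl [z]) :
    ((FreeGroup.mk (a :: w) : F k) • x).1 0 = a :=
  (mem_listCyl_cons.1 ((mk_smul_mem_listCyl_append (by simp) hw).2 hx)).1

theorem exists_cyclLength_le_of_isCyclicallyReduced (hk : 2 ≤ k)
    {μA : Measure (Boundary k)} [IsProbabilityMeasure μA]
    (hμA : ∀ v : F k, v ≠ 1 →
      μA (Cyl k v) = ((2 * k : ℝ≥0∞) * (2 * k - 1) ^ (wordLength k v - 1))⁻¹)
    {ηA : Measure (Boundary k × Boundary k)} (hηA : IsCurrent k ηA)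
    (hηA' : ∀ x y : F k, ηA (Cyl2 k x y) = μA (Cyl k (x⁻¹ * y)))
    {bd : MulAut (F k) → Boundary k → Boundary k}
    (hbd : ∀ Φ : MulAut (F k), IsBdryExt k Φ (bd Φ)) {S : ℝ≥0∞} (hS : S < ⊤)
    {w : List (L k)} (hw : FreeGroup.IsCyclicallyReduced w) (hw0 : w ≠ []) :
    ∃ M : ℕ, ∀ Φ : MulAut (F k), autLen k ηA (bd Φ) ≤ S →
      cyclLength k (Φ (FreeGroup.mk w)) ≤ M := by
  obtain ⟨a, t, hat⟩ := List.exists_cons_of_ne_nil hw0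
  obtain ⟨s, e, hse⟩ := List.eq_nil_or_concat' w |>.resolve_left hw0
  have hhead : ∀ b ∈ w.head?, b = a := by rw [hat]; simp
  have hlast : ∀ b ∈ w.getLast?, b = e := by rw [hse]; simp
  have hae : a ≠ linv k e := isReduced_rel_iff.1 (hw.2 e (by rw [hse]; simp) a (by rw [hat]; simp))
  obtain ⟨z, hza, hze⟩ := exists_letter_ne hk a (linv k e)
  have hred : FreeGroup.IsReduced (linv k z :: (w ++ [z])) :=
    isReduced_linv_cons_append hw.isReduced hw0 (fun b hb => by rwa [hhead b hb])
      (fun b hb => by rwa [hlast b hb])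
  have hww : FreeGroup.IsReduced (w ++ w) := by
    simpa using (hw.flatten_replicate 2).isReduced
  have hred2 : FreeGroup.IsReduced (linv k z :: (w ++ w ++ [z])) :=
    isReduced_linv_cons_append hww (by simp [hw0])
      (fun b hb => by
        rw [List.head?_append_of_ne_nil _ hw0] at hb
        rwa [hhead b hb])
      (fun b hb => by
        rw [List.getLast?_append_of_ne_nil _ hw0] at hb
        rwa [hlast b hb])
  obtain ⟨c, hc0, hc⟩ := exists_current_prod_eq hk hμA hηA' hred
  obtain ⟨c', hc0', hc'⟩ := exists_current_prod_eq hk hμA hηA' hred2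
  have hf : ∀ x ∈ listCyl [z], ((FreeGroup.mk w : F k) • x).1 0 = a := by
    intro x hx
    have := (isReduced_cons_iff.1 hred).2
    rw [hat] at this ⊢
    exact mk_smul_head this hx
  have hf' : ∀ x ∈ listCyl [z], ((FreeGroup.mk w : F k)⁻¹ • x).1 0 = linv k e := by
    intro x hx
    have h1 : FreeGroup.IsReduced (linv k z :: w) := List.IsChain.left_of_append (l₂ := [z]) hred
    have h2 : FreeGroup.IsReduced (FreeGroup.invRev (linv k z :: w)) := by
      rw [FreeGroup.isReduced_iff_reduce_eq, FreeGroup.reduce_invRev, h1.reduce_eq]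
    rw [FreeGroup.inv_mk]
    have h3 : FreeGroup.invRev w = linv k e :: FreeGroup.invRev s := by
      rw [hse]
      simp [FreeGroup.invRev, linv]
    have h4 : FreeGroup.invRev (linv k z :: w) = FreeGroup.invRev w ++ [z] := by
      simp [FreeGroup.invRev, linv]
    rw [h4, h3] at h2
    rw [h3]
    exact mk_smul_head h2 hx
  have hpos : μA (listCyl [z]) ≠ 0 := by
    have hz := toWord_mk_of_isReduced (l := [z]) (FreeGroup.isReduced_iff_reduce_eq.2 rfl)
    have h := hμA (FreeGroup.mk [z]) (by
      rw [Ne, ← FreeGroup.toWord_eq_nil_iff, hz]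
      simp)
    rw [Cyl_eq_listCyl, hz] at h
    rw [h]
    exact cylMass_ne_zero _
  set ε := c * c' * (μA (listCyl [z]) / 2) ^ 4 with hε
  have hε0 : ε ≠ 0 := mul_ne_zero (mul_ne_zero hc0 hc0')
    (pow_ne_zero _ (ENNReal.half_pos hpos).ne')
  obtain ⟨M, hM⟩ := ENNReal.exists_nat_gt
    (ENNReal.div_ne_top (ENNReal.mul_ne_top hS.ne hS.ne) hε0)
  refine ⟨M, fun Φ hΦ => ?_⟩
  have hf1 : Φ (FreeGroup.mk w) ≠ 1 := by
    rw [Ne, map_eq_one_iff Φ Φ.injective, ← FreeGroup.toWord_eq_nil_iff,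
      toWord_mk_of_isReduced hw.isReduced]
    exact hw0
  obtain ⟨N, v, l, hN, hA⟩ := exists_isAxis hf1
  have h := translation_mul_le hηA hk hza hze hae hf hf' hc
    (by rw [FreeGroup.mul_mk]; exact hc') hpos (hbd Φ) (hbd Φ⁻¹) (hΦ.trans_lt hS).ne hA
  have h' : (N : ℝ≥0∞) ≤ S * S / ε :=
    (ENNReal.le_div_iff_mul_le (Or.inl hε0) (Or.inr (ENNReal.mul_ne_top hS.ne hS.ne))).2
      (h.trans (mul_le_mul' hΦ hΦ))
  exact hN.trans (by exact_mod_cast (h'.trans_lt hM).le)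

theorem cyclLength_conj_le (h g : F k) : cyclLength k (g * h * g⁻¹) ≤ cyclLength k h := by
  obtain ⟨u, hu⟩ := Nat.sInf_mem (s := { n | ∃ g : F k, wordLength k (g * h * g⁻¹) = n })
    ⟨_, 1, rfl⟩
  refine Nat.sInf_le ⟨u * g⁻¹, ?_⟩
  rw [← show _ = cyclLength k h from hu]
  congr 1
  group

end Helpers

theorem bounded_length_bounds_cyclic_lengths (k : ℕ) (hk : 2 ≤ k)
    (μA : Measure (Boundary k)) [IsProbabilityMeasure μA]
    (hμA : ∀ v : F k, v ≠ 1 →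
      μA (Cyl k v) = ((2 * k : ℝ≥0∞) * (2 * k - 1) ^ (wordLength k v - 1))⁻¹)
    (ηA : Measure (Boundary k × Boundary k)) (hηA : IsCurrent k ηA)
    (hηA' : ∀ x y : F k, ηA (Cyl2 k x y) = μA (Cyl k (x⁻¹ * y)))
    (bd : MulAut (F k) → Boundary k → Boundary k)
    (hbd : ∀ Φ : MulAut (F k), IsBdryExt k Φ (bd Φ))
    (Φ : ℕ → MulAut (F k))
    (hbound : (⨆ n, autLen k ηA (bd (Φ n))) < ⊤) :
    ∀ f : F k, ∃ M : ℕ, ∀ n, cyclLength k (Φ n f) ≤ M := by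
  intro f
  set w := FreeGroup.reduceCyclically f.toWord
  set c : F k := FreeGroup.mk (FreeGroup.reduceCyclically.conjugator f.toWord)
  have hconj : c * FreeGroup.mk w * c⁻¹ = f := conjugator_mul_reduceCyclically f
  have hred : ∀ n, cyclLength k (Φ n f) ≤ cyclLength k (Φ n (FreeGroup.mk w)) := fun n => by
    rw [← hconj, map_mul, map_mul, map_inv]
    exact cyclLength_conj_le _ _
  by_cases hw0 : w = []
  · refine ⟨cyclLength k 1, fun n => (hred n).trans (le_of_eq ?_)⟩
    rw [hw0, ← FreeGroup.one_eq_mk, map_one]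
  · obtain ⟨M, hM⟩ := exists_cyclLength_le_of_isCyclicallyReduced hk hμA hηA hηA' hbd hbound
      (FreeGroup.reduceCyclically.isCyclicallyReduced FreeGroup.isReduced_toWord) hw0
    exact ⟨M, fun n => (hred n).trans
      (hM _ (le_iSup (fun n => autLen k ηA (bd (Φ n))) n))⟩

end

end FGC
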